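/- arXiv:1801.08382 — 8 statements merged into one kernel-verified Lean document; each statement's English description precedes it below -/
import Mathlib

section
/- Let 0 < a_l ≤ a_u and λ > 0. Let f ∈ L¹(ℝ³) be nonnegative with ∫_{ℝ³} f q₀^{−2} dq ≥ a_l, ∫_{ℝ³} f dq ≤ a_u, and α_f ≤ √λ. Then the macroscopic quantities constructed from f satisfy a_l ≤ n_f ≤ a_u, |u_f| ≤ √2 a_u / a_l, and a_l/a_u ≤ α_f ≤ √λ. -/
open MeasureTheory Real Set

noncomputable section

abbrev E3 := EuclideanSpace ℝ (Fin 3)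

/-- `q₀ = √(1+|q|²)` -/
def q0 (q : E3) : ℝ := Real.sqrt (1 + ‖q‖ ^ 2)

/-- proper particle density `n_f` (nonnegative, with `n_f² = (∫f)² - Σᵢ (∫ f qᵢ/q₀)²`) -/
def nDens (f : E3 → ℝ) : ℝ :=
  Real.sqrt ((∫ q, f q) ^ 2 - ∑ i : Fin 3, (∫ q, f q * (q i / q0 q)) ^ 2)

/-- velocity `u_f = (1/n_f) ∫ f q/q₀` -/
def uVel (f : E3 → ℝ) : E3 :=
  (nDens f)⁻¹ • ∫ q, f q • ((q0 q)⁻¹ • q)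

/-- `α_f = (1/n_f) ∫ f/q₀` -/
def alphaF (f : E3 → ℝ) : ℝ := (nDens f)⁻¹ * ∫ q, f q / q0 q

lemma one_le_q0 (q : E3) : 1 ≤ q0 q := by
  rw [q0, Real.one_le_sqrt]
  nlinarith [sq_nonneg ‖q‖]

lemma q0_pos (q : E3) : 0 < q0 q := zero_lt_one.trans_le (one_le_q0 q)

lemma q0_sq (q : E3) : q0 q ^ 2 = 1 + ‖q‖ ^ 2 := Real.sq_sqrt (by positivity)

lemma norm_le_q0 (q : E3) : ‖q‖ ≤ q0 q := Real.le_sqrt_of_sq_le (by linarith)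

lemma continuous_q0 : Continuous q0 := by
  unfold q0
  fun_prop

lemma integrable_mul_of_abs_le_one {f g : E3 → ℝ} (hf : Integrable f) (hg : Continuous g)
    (hg1 : ∀ q, |g q| ≤ 1) : Integrable fun q => f q * g q :=
  hf.mul_bdd hg.aestronglyMeasurable (Filter.Eventually.of_forall hg1)

lemma integrable_div_q0 {f : E3 → ℝ} (hf : Integrable f) : Integrable fun q => f q / q0 q := by
  simp only [div_eq_mul_inv]
  refine integrable_mul_of_abs_le_one hf (continuous_q0.inv₀ fun q => (q0_pos q).ne') fun q => ?_
  rw [abs_of_pos (inv_pos.2 (q0_pos q))]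
  exact inv_le_one_of_one_le₀ (one_le_q0 q)

lemma integrable_mul_coord_div_q0 {f : E3 → ℝ} (hf : Integrable f) (i : Fin 3) :
    Integrable fun q => f q * (q i / q0 q) := by
  refine integrable_mul_of_abs_le_one hf
    ((by fun_prop : Continuous fun q : E3 => q i).div continuous_q0 fun q => (q0_pos q).ne')
    fun q => ?_
  rw [abs_div, abs_of_pos (q0_pos q), div_le_one (q0_pos q)]
  exact (PiLp.norm_apply_le q i).trans (norm_le_q0 q)

/-- The unit vector `(1, q) / q₀` of `ℝ⁴` has inner product at most `|(a, p)|` with `(a, p)`. -/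
lemma unit_vector_inner_le (a : ℝ) (p : Fin 3 → ℝ) (q : E3) :
    a / q0 q + ∑ i, p i * (q i / q0 q) ≤ √(a ^ 2 + ∑ i, p i ^ 2) := by
  have hq := q0_pos q
  have hsq := q0_sq q
  apply Real.le_sqrt_of_sq_le
  rw [EuclideanSpace.real_norm_sq_eq] at hsq
  have key : a / q0 q + ∑ i, p i * (q i / q0 q) = (a + ∑ i, p i * q i) / q0 q := by
    simp only [add_div, Finset.sum_div, mul_div_assoc]
  rw [key, div_pow, div_le_iff₀ (pow_pos hq 2), hsq]
  simp only [Fin.sum_univ_three]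
  nlinarith [sq_nonneg (a * q 0 - p 0), sq_nonneg (a * q 1 - p 1), sq_nonneg (a * q 2 - p 2),
    sq_nonneg (p 0 * q 1 - p 1 * q 0), sq_nonneg (p 0 * q 2 - p 2 * q 0),
    sq_nonneg (p 1 * q 2 - p 2 * q 1)]

lemma sq_integral_div_q0_add_sum_le {f : E3 → ℝ} (hf : Integrable f) (hf0 : ∀ q, 0 ≤ f q) :
    (∫ q, f q / q0 q) ^ 2 + ∑ i : Fin 3, (∫ q, f q * (q i / q0 q)) ^ 2 ≤ (∫ q, f q) ^ 2 := by
  set a := ∫ q, f q / q0 q with ha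
  set p : Fin 3 → ℝ := fun i => ∫ q, f q * (q i / q0 q) with hp
  set R := √(a ^ 2 + ∑ i, p i ^ 2) with hR
  have hR2 : R ^ 2 = a ^ 2 + ∑ i, p i ^ 2 := Real.sq_sqrt (by positivity)
  have hia := (integrable_div_q0 hf).const_mul a
  have hip := fun i => (integrable_mul_coord_div_q0 hf i).const_mul (p i)
  have hsum : Integrable fun q => ∑ i, p i * (f q * (q i / q0 q)) :=
    integrable_finsetSum _ fun i _ => hip i
  have hint : R ^ 2 = ∫ q, (a * (f q / q0 q) + ∑ i, p i * (f q * (q i / q0 q))) := by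
    rw [integral_add hia hsum, integral_finsetSum _ fun i _ => hip i, hR2]
    simp only [integral_const_mul, ← ha]
    simp only [hp, sq]
  have hle : R ^ 2 ≤ (∫ q, f q) * R := by
    rw [hint, ← integral_mul_const]
    refine integral_mono (hia.add hsum) (hf.mul_const R) fun q => ?_
    calc a * (f q / q0 q) + ∑ i, p i * (f q * (q i / q0 q))
        = f q * (a / q0 q + ∑ i, p i * (q i / q0 q)) := by
          rw [mul_add, Finset.mul_sum]
          congr 1
          · ring
          · exact Finset.sum_congr rfl fun i _ => by ring
      _ ≤ f q * R := mul_le_mul_of_nonneg_left (unit_vector_inner_le a p q) (hf0 q)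
  have hN : 0 ≤ ∫ q, f q := integral_nonneg hf0
  have hRN : R ≤ ∫ q, f q := by
    by_contra! h
    nlinarith
  change a ^ 2 + ∑ i, p i ^ 2 ≤ _
  rw [← hR2]
  exact pow_le_pow_left₀ (Real.sqrt_nonneg _) hRN 2

lemma integral_div_q0_le_nDens {f : E3 → ℝ} (hf : Integrable f) (hf0 : ∀ q, 0 ≤ f q) :
    ∫ q, f q / q0 q ≤ nDens f :=
  Real.le_sqrt_of_sq_le (by linarith [sq_integral_div_q0_add_sum_le hf hf0])

lemma nDens_le_integral {f : E3 → ℝ} (hf0 : ∀ q, 0 ≤ f q) : nDens f ≤ ∫ q, f q :=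
  Real.sqrt_le_iff.2 ⟨integral_nonneg hf0, sub_le_self _ (by positivity)⟩

lemma integral_div_q0_sq_le {f : E3 → ℝ} (hf : Integrable f) (hf0 : ∀ q, 0 ≤ f q) :
    ∫ q, f q / q0 q ^ 2 ≤ ∫ q, f q / q0 q := by
  refine integral_mono_of_nonneg (Filter.Eventually.of_forall fun q => ?_) (integrable_div_q0 hf)
    (Filter.Eventually.of_forall fun q => ?_)
  · exact div_nonneg (hf0 q) (sq_nonneg _)
  · exact div_le_div_of_nonneg_left (hf0 q) (q0_pos q)
      (le_self_pow₀ (one_le_q0 q) two_ne_zero)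

lemma norm_integral_smul_le {f : E3 → ℝ} (hf : Integrable f) (hf0 : ∀ q, 0 ≤ f q) :
    ‖∫ q, f q • ((q0 q)⁻¹ • q)‖ ≤ ∫ q, f q := by
  refine norm_integral_le_of_norm_le hf (Filter.Eventually.of_forall fun q => ?_)
  rw [norm_smul, norm_smul, Real.norm_of_nonneg (hf0 q),
    Real.norm_of_nonneg (inv_pos.2 (q0_pos q)).le]
  refine mul_le_of_le_one_right (hf0 q) ?_
  rw [inv_mul_le_one₀ (q0_pos q)]
  exact norm_le_q0 q

/-- Bounds on the macroscopic quantities `n_f, u_f, α_f` for `f`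
in the solution space. -/
theorem macro_bounds (a_l a_u lam : ℝ) (hal : 0 < a_l) (hala : a_l ≤ a_u) (hlam : 0 < lam)
    (f : E3 → ℝ) (hf : Integrable f) (hf0 : ∀ q, 0 ≤ f q)
    (h1 : a_l ≤ ∫ q, f q / (q0 q) ^ 2)
    (h2 : (∫ q, f q) ≤ a_u)
    (h3 : alphaF f ≤ Real.sqrt lam) :
    (a_l ≤ nDens f ∧ nDens f ≤ a_u) ∧
    ‖uVel f‖ ≤ Real.sqrt 2 * a_u / a_l ∧
    (a_l / a_u ≤ alphaF f ∧ alphaF f ≤ Real.sqrt lam) := by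
  have hA := h1.trans (integral_div_q0_sq_le hf hf0)
  have hn := hA.trans (integral_div_q0_le_nDens hf hf0)
  have hnu := (nDens_le_integral hf0).trans h2
  have hn0 : 0 < nDens f := hal.trans_le hn
  refine ⟨⟨hn, hnu⟩, ?_, ?_, h3⟩
  · have hau : 0 ≤ a_u := hal.le.trans hala
    have hsqrt : 1 ≤ √2 := Real.one_le_sqrt.2 one_le_two
    rw [uVel, norm_smul, Real.norm_of_nonneg (inv_pos.2 hn0).le, inv_mul_eq_div]
    calc _ ≤ a_u / a_l := div_le_div₀ hau ((norm_integral_smul_le hf hf0).trans h2) hal hn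
      _ ≤ √2 * a_u / a_l := by
        gcongr
        exact le_mul_of_one_le_left hau hsqrt
  · rw [alphaF, inv_mul_eq_div]
    exact div_le_div₀ (hal.le.trans hA) hA hn0 hnu
end
end

section
/- Let 0 < w < 1, x ∈ [0,1], and C₁, C₂ > 0. Let g : [0,1] × ℝ³ → ℝ be measurable with 0 ≤ g(y,q) ≤ C₁ e^{−C₂ √(1+|q|²)} for all (y,q). Then ∫_{q₁>0} (w/q₁) ∫₀ˣ e^{−(w/q₁)(x−y)} g(y,q) dy dq + ∫_{q₁<0} (w/|q₁|) ∫ₓ¹ e^{−(w/|q₁|)(y−x)} g(y,q) dy dq ≤ (16 C₁ / C₂²) (2 w ln(1/w) + (1+e) w + (√2 w² / C₂) e^{−C₂/(√2 w)}). -/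
open MeasureTheory Real Set

noncomputable section

theorem integral_exp_neg_mul_abs {c : ℝ} (hc : 0 < c) :
    ∫ t : ℝ, exp (-c * |t|) = 2 / c := by
  rw [integral_comp_abs (f := fun t => exp (-c * t)),
    integral_exp_mul_Ioi (neg_lt_zero.mpr hc)]
  simp [div_eq_mul_inv]

theorem integrable_exp_neg_mul_abs {c : ℝ} (hc : 0 < c) :
    Integrable fun t : ℝ => exp (-c * |t|) := by
  by_contra h
  have h2 : 0 < 2 / c := by positivity
  rw [← integral_exp_neg_mul_abs hc, integral_undef h] at h2
  exact lt_irrefl _ h2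

/-- The exponential average over `[0, a]` of a function with values in `[0, M]` is at most
`M * min 1 (k * a)`. -/
theorem mul_integral_exp_neg_mul_le {k a M : ℝ} (hk : 0 < k) (ha : 0 ≤ a) {f : ℝ → ℝ}
    (hf : ∀ t, 0 ≤ f t ∧ f t ≤ M) :
    0 ≤ k * ∫ t in (0 : ℝ)..a, exp (-k * t) * f t ∧
      (k * ∫ t in (0 : ℝ)..a, exp (-k * t) * f t) ≤ M ∧
      (k * ∫ t in (0 : ℝ)..a, exp (-k * t) * f t) ≤ k * a * M := by
  have hM : 0 ≤ M := (hf 0).1.trans (hf 0).2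
  have hnonneg (t : ℝ) : 0 ≤ exp (-k * t) * f t := mul_nonneg (exp_pos _).le (hf t).1
  rw [intervalIntegral.integral_of_le ha]
  refine ⟨mul_nonneg hk.le (integral_nonneg hnonneg), ?_, ?_⟩
  · have hint : IntegrableOn (fun t => exp (-k * t) * M) (Ioi 0) :=
      (integrableOn_exp_mul_Ioi (neg_lt_zero.mpr hk) 0).mul_const M
    have h : ∫ t in Ioc 0 a, exp (-k * t) * f t ≤ M / k := calc
      _ ≤ ∫ t in Ioc 0 a, exp (-k * t) * M :=
        integral_mono_of_nonneg (ae_of_all _ hnonneg) (hint.mono_set Ioc_subset_Ioi_self)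
          (ae_of_all _ fun t => mul_le_mul_of_nonneg_left (hf t).2 (exp_pos _).le)
      _ ≤ ∫ t in Ioi 0, exp (-k * t) * M :=
        setIntegral_mono_set hint
          (ae_of_all _ fun t => mul_nonneg (exp_pos _).le hM)
          (ae_of_all _ fun _ ht => Ioc_subset_Ioi_self ht)
      _ = M / k := by
        rw [integral_mul_const, integral_exp_mul_Ioi (neg_lt_zero.mpr hk)]
        simp [div_eq_mul_inv, mul_comm]
    rw [le_div_iff₀ hk] at h
    linarith
  · have h : ∫ t in Ioc 0 a, exp (-k * t) * f t ≤ a * M := calc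
      _ ≤ ∫ t in Ioc 0 a, M := by
        refine integral_mono_of_nonneg (ae_of_all _ hnonneg) (by simp) ?_
        filter_upwards [ae_restrict_mem measurableSet_Ioc] with t ht
        have : exp (-k * t) ≤ 1 := exp_le_one_iff.mpr (by nlinarith [ht.1])
        calc _ ≤ 1 * f t := mul_le_mul_of_nonneg_right this (hf t).1
          _ ≤ M := by linarith [(hf t).2]
      _ = a * M := by simp [ha]
    calc _ ≤ k * (a * M) := mul_le_mul_of_nonneg_left h hk.le
      _ = _ := by ring

/-- A majorant of `p ↦ min 1 (a * w / p) * exp (-c * p)` on the positive half-line. -/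
def fluxMajorant (w a c p : ℝ) : ℝ :=
  (Ioc 0 w).indicator (fun _ => 1) p + (Ioc w (1 / w)).indicator (fun p => a * w * p⁻¹) p
    + (Ioi (1 / w)).indicator (fun p => a * w ^ 2 * exp (-c * p)) p

theorem fluxMajorant_nonneg {w a : ℝ} (c p : ℝ) (hw : 0 < w) (ha : 0 ≤ a) :
    0 ≤ fluxMajorant w a c p := by
  unfold fluxMajorant
  refine add_nonneg (add_nonneg ?_ ?_) ?_
  · exact indicator_nonneg (fun _ _ => zero_le_one) p
  · refine indicator_nonneg (fun p hp => ?_) p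
    have := hw.trans hp.1
    positivity
  · exact indicator_nonneg (fun p _ => by positivity) p

theorem le_fluxMajorant {w a c p A M : ℝ} (hw0 : 0 < w) (hw1 : w < 1) (ha : 0 ≤ a)
    (hc : 0 < c) (hp : 0 < p) (hM : 0 ≤ M) (h1 : A ≤ M * exp (-c * p))
    (h2 : A ≤ w / p * a * (M * exp (-c * p))) : A ≤ M * fluxMajorant w a c p := by
  have hww : w < 1 / w := by
    rw [lt_div_iff₀ hw0]
    nlinarith
  have he : exp (-c * p) ≤ 1 := exp_le_one_iff.mpr (by nlinarith)
  unfold fluxMajorant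
  rcases le_or_gt p w with h | h
  · rw [indicator_of_mem (show p ∈ Ioc 0 w from ⟨hp, h⟩),
      indicator_of_notMem (fun h' => h'.1.not_ge h),
      indicator_of_notMem (show p ∉ Ioi (1 / w) from (h.trans hww.le).not_gt)]
    nlinarith
  rcases le_or_gt p (1 / w) with h' | h'
  · rw [indicator_of_notMem (fun h' => h'.2.not_gt h),
      indicator_of_mem (show p ∈ Ioc w (1 / w) from ⟨h, h'⟩),
      indicator_of_notMem (show p ∉ Ioi (1 / w) from h'.not_gt)]
    calc A ≤ _ := h2
      _ ≤ w / p * a * (M * 1) := by gcongr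
      _ = _ := by ring
  · rw [indicator_of_notMem (fun h' => h'.2.not_gt h),
      indicator_of_notMem (fun h'' => h''.2.not_gt h'),
      indicator_of_mem (show p ∈ Ioi (1 / w) from h')]
    have : w / p ≤ w * w := by
      rw [div_le_iff₀ hp]
      rw [div_lt_iff₀ hw0] at h'
      nlinarith
    calc A ≤ _ := h2
      _ ≤ w * w * a * (M * exp (-c * p)) := by gcongr
      _ = _ := by ring

theorem integrable_and_integral_fluxMajorant {w : ℝ} (a : ℝ) {c : ℝ} (hw0 : 0 < w) (hw1 : w < 1)
    (hc : 0 < c) :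
    Integrable (fluxMajorant w a c) ∧
      ∫ p, fluxMajorant w a c p
        = w + 2 * a * w * log (1 / w) + a * w ^ 2 / c * exp (-c * (1 / w)) := by
  have hww : w ≤ 1 / w := by
    rw [le_div_iff₀ hw0]
    nlinarith
  have i1 : Integrable ((Ioc 0 w).indicator (fun _ : ℝ => (1 : ℝ))) :=
    (integrable_indicator_iff measurableSet_Ioc).mpr (by simp)
  have i2 : Integrable ((Ioc w (1 / w)).indicator (fun p => a * w * p⁻¹)) := by
    rw [integrable_indicator_iff measurableSet_Ioc,
      ← intervalIntegrable_iff_integrableOn_Ioc_of_le hww]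
    refine IntervalIntegrable.const_mul (intervalIntegral.intervalIntegrable_inv ?_ ?_) _
    · intro p hp
      rw [uIcc_of_le hww] at hp
      exact (hw0.trans_le hp.1).ne'
    · exact continuousOn_id
  have i3 : Integrable ((Ioi (1 / w)).indicator (fun p => a * w ^ 2 * exp (-c * p))) :=
    (integrable_indicator_iff measurableSet_Ioi).mpr
      ((integrableOn_exp_mul_Ioi (neg_lt_zero.mpr hc) _).const_mul _)
  refine ⟨(i1.add i2).add i3, ?_⟩
  unfold fluxMajorant
  rw [integral_add (by exact i1.add i2) i3, integral_add i1 i2, integral_indicator measurableSet_Ioc,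
    integral_indicator measurableSet_Ioc, integral_indicator measurableSet_Ioi,
    integral_const_mul, integral_const_mul, ← intervalIntegral.integral_of_le hww,
    integral_inv_of_pos hw0 (by positivity), integral_exp_mul_Ioi (neg_lt_zero.mpr hc),
    log_div (by positivity) hw0.ne', one_div, log_inv]
  simp [hw0.le]
  ring

theorem half_weighted_sum_le_norm (q : E3) {p : ℝ} (hp : |q 0| = p) :
    p / √2 + (|q 1| + |q 2|) / 2 ≤ √(1 + ‖q‖ ^ 2) := by
  have h2 : √2 ^ 2 = 2 := sq_sqrt (by norm_num)
  have hq : ‖q‖ ^ 2 = p ^ 2 + |q 1| ^ 2 + |q 2| ^ 2 := by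
    rw [EuclideanSpace.norm_sq_eq, Fin.sum_univ_three, ← hp]
    simp
  have hs : p / √2 = p * √2 / 2 := by
    rw [div_eq_div_iff (by positivity) (by norm_num)]
    linear_combination (-p) * h2
  apply le_sqrt_of_sq_le
  rw [hq, hs]
  nlinarith [sq_nonneg (|q 1| - |q 2|), sq_nonneg (p * √2 - (|q 1| + |q 2|))]

/-- Integral over a subset of `E3` of a function dominated by a product
`φ (q 0) * exp (-c * |q 1|) * exp (-c * |q 2|)`. -/
theorem setIntegral_le_of_le_prod {c C : ℝ} (hc : 0 < c) (hC : 0 ≤ C) {φ : ℝ → ℝ}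
    (hφ : Integrable φ) (hφ0 : ∀ p, 0 ≤ φ p) {H : Set E3} (hH : MeasurableSet H) {F : E3 → ℝ}
    (hF : ∀ q ∈ H, 0 ≤ F q ∧ F q ≤ C * exp (-c * |q 1|) * exp (-c * |q 2|) * φ (q 0)) :
    ∫ q in H, F q ≤ C * (2 / c) ^ 2 * ∫ p, φ p := by
  let f : Fin 3 → ℝ → ℝ := ![φ, fun t => exp (-c * |t|), fun t => exp (-c * |t|)]
  have hf : ∀ i, Integrable (f i) := by
    intro i
    fin_cases i
    · exact hφ
    · exact integrable_exp_neg_mul_abs hc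
    · exact integrable_exp_neg_mul_abs hc
  have heq (q : E3) : C * exp (-c * |q 1|) * exp (-c * |q 2|) * φ (q 0)
      = C * ∏ i, f i (q.ofLp i) := by
    simp only [Fin.prod_univ_three, f]
    simp
    ring
  have hmp := EuclideanSpace.volume_preserving_symm_measurableEquiv_toLp (Fin 3)
  have hint : Integrable fun q : E3 => C * ∏ i, f i (q.ofLp i) :=
    ((hmp.integrable_comp_emb (MeasurableEquiv.measurableEmbedding _)).mpr
      (Integrable.fintype_prod hf)).const_mul C
  have hval : ∫ q : E3, C * ∏ i, f i (q.ofLp i) = C * (2 / c) ^ 2 * ∫ p, φ p := by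
    rw [integral_const_mul]
    have := hmp.integral_comp (MeasurableEquiv.measurableEmbedding _)
      (fun v : Fin 3 → ℝ => ∏ i, f i (v i))
    refine (congrArg (C * ·) (this.trans (integral_fintype_prod_volume_eq_prod f))).trans ?_
    simp only [Fin.prod_univ_three, f]
    simp [integral_exp_neg_mul_abs hc, -neg_mul]
    ring
  rw [← hval]
  calc ∫ q in H, F q ≤ ∫ q in H, C * ∏ i, f i (q.ofLp i) := by
        refine integral_mono_of_nonneg ?_ hint.integrableOn ?_
        · filter_upwards [ae_restrict_mem hH] with q hq using (hF q hq).1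
        · filter_upwards [ae_restrict_mem hH] with q hq
          rw [← heq]
          exact (hF q hq).2
    _ ≤ _ := by
        refine setIntegral_le_integral hint (ae_of_all _ fun q => ?_)
        change 0 ≤ C * ∏ i, f i (q.ofLp i)
        rw [← heq]
        have := hφ0 (q 0)
        positivity

/-- Pointwise bound for the velocity density of the transported term, with `p = |q 0|`. -/
theorem transported_density_bound {w a C1 C2 p : ℝ} (hw0 : 0 < w) (hw1 : w < 1) (ha : 0 ≤ a)
    (hC1 : 0 < C1) (hC2 : 0 < C2) (hp : 0 < p) {q : E3} (hq : |q 0| = p) {f : ℝ → ℝ}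
    (hf : ∀ t, 0 ≤ f t ∧ f t ≤ C1 * exp (-C2 * √(1 + ‖q‖ ^ 2))) :
    0 ≤ w / p * ∫ t in (0 : ℝ)..a, exp (-(w / p) * t) * f t ∧
      (w / p * ∫ t in (0 : ℝ)..a, exp (-(w / p) * t) * f t)
        ≤ C1 * exp (-(C2 / 2) * |q 1|) * exp (-(C2 / 2) * |q 2|)
          * fluxMajorant w a (C2 / √2) p := by
  have hM : C1 * exp (-C2 * √(1 + ‖q‖ ^ 2))
      ≤ C1 * exp (-(C2 / 2) * |q 1|) * exp (-(C2 / 2) * |q 2|) * exp (-(C2 / √2) * p) := by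
    rw [mul_assoc, mul_assoc, ← exp_add, ← exp_add]
    gcongr
    have := mul_le_mul_of_nonneg_left (half_weighted_sum_le_norm q hq) hC2.le
    calc -C2 * √(1 + ‖q‖ ^ 2) ≤ -(C2 * (p / √2 + (|q 1| + |q 2|) / 2)) := by linarith
      _ = _ := by ring
  obtain ⟨h0, h1, h2⟩ := mul_integral_exp_neg_mul_le (div_pos hw0 hp) ha
    fun t => ⟨(hf t).1, (hf t).2.trans hM⟩
  exact ⟨h0, le_fluxMajorant hw0 hw1 ha (by positivity) hp (by positivity) h1 h2⟩

/-- Smallness estimate for the transported Maxwellian-type term in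
terms of the collision frequency `w`. -/
theorem transported_gaussian_smallness (w x C1 C2 : ℝ)
    (hw0 : 0 < w) (hw1 : w < 1) (hx : x ∈ Set.Icc (0:ℝ) 1)
    (hC1 : 0 < C1) (hC2 : 0 < C2) (g : ℝ → E3 → ℝ)
    (hmeas : Measurable (Function.uncurry g))
    (hg : ∀ y q, 0 ≤ g y q ∧ g y q ≤ C1 * Real.exp (-C2 * Real.sqrt (1 + ‖q‖ ^ 2))) :
    (∫ q in {q : E3 | 0 < q 0},
        (w / q 0) * ∫ y in (0:ℝ)..x, Real.exp (-(w / q 0) * (x - y)) * g y q)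
      + (∫ q in {q : E3 | q 0 < 0},
        (w / |q 0|) * ∫ y in x..(1:ℝ), Real.exp (-(w / |q 0|) * (y - x)) * g y q)
      ≤ 16 * C1 / C2 ^ 2 * (2 * w * Real.log (1 / w) + (1 + Real.exp 1) * w
          + Real.sqrt 2 * w ^ 2 / C2 * Real.exp (-C2 / (Real.sqrt 2 * w))) := by
  obtain ⟨hx0, hx1⟩ := hx
  have hx1' : 0 ≤ 1 - x := sub_nonneg.mpr hx1
  have hc : 0 < C2 / √2 := by positivity
  obtain ⟨i1, v1⟩ := integrable_and_integral_fluxMajorant x hw0 hw1 hc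
  obtain ⟨i2, v2⟩ := integrable_and_integral_fluxMajorant (1 - x) hw0 hw1 hc
  have m0 : Measurable fun q : E3 => q 0 := by fun_prop
  have b1 := setIntegral_le_of_le_prod (half_pos hC2) hC1.le i1
    (fun p => fluxMajorant_nonneg _ p hw0 hx0)
    (H := {q : E3 | 0 < q 0}) (measurableSet_lt measurable_const m0)
    (F := fun q => (w / q 0) * ∫ y in (0:ℝ)..x, Real.exp (-(w / q 0) * (x - y)) * g y q)
    (fun q hq => by
      have := transported_density_bound hw0 hw1 hx0 hC1 hC2 hq (abs_of_pos hq)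
        (f := fun t => g (x - t) q) (fun t => hg _ _)
      have e := intervalIntegral.integral_comp_sub_left (a := 0) (b := x)
        (fun t => exp (-(w / q 0) * t) * g (x - t) q) x
      simp only [sub_sub_cancel, sub_self, sub_zero] at e
      rwa [← e] at this)
  have b2 := setIntegral_le_of_le_prod (half_pos hC2) hC1.le i2.comp_neg
    (fun p => fluxMajorant_nonneg _ (-p) hw0 hx1')
    (H := {q : E3 | q 0 < 0}) (measurableSet_lt m0 measurable_const)
    (F := fun q => (w / |q 0|) * ∫ y in x..(1:ℝ), Real.exp (-(w / |q 0|) * (y - x)) * g y q)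
    (fun q hq => by
      have hq' : |q 0| = -q 0 := abs_of_neg hq
      have := transported_density_bound hw0 hw1 hx1' hC1 hC2 (neg_pos.mpr hq) hq'
        (f := fun t => g (x + t) q) (fun t => hg _ _)
      have e := intervalIntegral.integral_comp_sub_right (a := x) (b := 1)
        (fun t => exp (-(w / |q 0|) * t) * g (x + t) q) x
      simp only [add_sub_cancel, sub_self] at e
      rw [← hq', ← e] at this
      rwa [← hq'])
  rw [integral_neg_eq_self (fluxMajorant w (1 - x) (C2 / √2)) volume, v2] at b2
  rw [v1] at b1
  refine (add_le_add b1 b2).trans ?_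
  have he : -(C2 / √2) * (1 / w) = -C2 / (√2 * w) := by
    field_simp
  rw [he]
  calc _ = 16 * C1 / C2 ^ 2 * (2 * w * log (1 / w) + 2 * w
        + √2 * w ^ 2 / C2 * exp (-C2 / (√2 * w))) := by
        field_simp
        ring
    _ ≤ _ := by
        gcongr
        linarith [add_one_le_exp (1 : ℝ)]
end
end

section
/- For every w with 0 < w < 1 and every x with 0 ≤ x ≤ 1: ∫₀^{1/w} (1 − e^{−wx/t}) dt ≤ 2 w ln(1/w) + (1+e) w. -/
open MeasureTheory Real Set

theorem integrableOn_one_sub_exp_neg_div {c a b : ℝ} (hc : 0 ≤ c) (ha : 0 ≤ a) :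
    IntegrableOn (fun t : ℝ => 1 - Real.exp (-c / t)) (Set.Ioc a b) := by
  refine Measure.integrableOn_of_bounded (M := 1) measure_Ioc_lt_top.ne
    (by fun_prop) ?_
  filter_upwards [ae_restrict_mem measurableSet_Ioc] with t ht
  have ht0 : 0 < t := ha.trans_lt ht.1
  have hle : Real.exp (-c / t) ≤ 1 :=
    Real.exp_le_one_iff.2 (div_nonpos_of_nonpos_of_nonneg (neg_nonpos.2 hc) ht0.le)
  rw [Real.norm_eq_abs, abs_le]
  constructor <;> linarith [Real.exp_pos (-c / t)]

theorem setIntegral_one_sub_exp_neg_div_le_sub {c a b : ℝ} (hc : 0 ≤ c) (ha : 0 ≤ a)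
    (hab : a ≤ b) :
    ∫ t in Set.Ioc a b, (1 - Real.exp (-c / t)) ≤ b - a := by
  calc ∫ t in Set.Ioc a b, (1 - Real.exp (-c / t))
      ≤ ∫ _ in Set.Ioc a b, (1 : ℝ) :=
        setIntegral_mono_on (integrableOn_one_sub_exp_neg_div hc ha)
          (integrableOn_const measure_Ioc_lt_top.ne) measurableSet_Ioc
          fun t _ => by linarith [Real.exp_pos (-c / t)]
    _ = b - a := by simp [hab]

theorem setIntegral_one_sub_exp_neg_div_le_mul_log {c a b : ℝ} (hc : 0 ≤ c) (ha : 0 < a)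
    (hab : a ≤ b) :
    ∫ t in Set.Ioc a b, (1 - Real.exp (-c / t)) ≤ c * Real.log (b / a) := by
  have hzero : (0 : ℝ) ∉ Set.uIcc a b := Set.notMem_uIcc_of_lt ha (ha.trans_le hab)
  have hint : IntegrableOn (fun t : ℝ => c * t⁻¹) (Set.Ioc a b) :=
    ((intervalIntegrable_iff_integrableOn_Ioc_of_le hab).1
      (intervalIntegral.intervalIntegrable_inv (fun t ht h => hzero (h ▸ ht))
        continuousOn_id)).const_mul c
  calc ∫ t in Set.Ioc a b, (1 - Real.exp (-c / t))
      ≤ ∫ t in Set.Ioc a b, c * t⁻¹ :=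
        setIntegral_mono_on (integrableOn_one_sub_exp_neg_div hc ha.le) hint measurableSet_Ioc
          fun t _ => by
            have h := Real.add_one_le_exp (-c / t)
            rw [neg_div, div_eq_mul_inv] at h
            rw [neg_div, div_eq_mul_inv]
            linarith
    _ = c * Real.log (b / a) := by
        rw [integral_const_mul, ← intervalIntegral.integral_of_le hab, integral_inv hzero]

/-- `∫₀^{1/w} (1 − e^{−wx/t}) dt ≤ 2w ln(1/w) + (1+e)w` for `0 < w < 1`
and `0 ≤ x ≤ 1`. -/
theorem one_sub_exp_integral_bound (w x : ℝ) (hw0 : 0 < w) (hw1 : w < 1)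
    (hx0 : 0 ≤ x) (hx1 : x ≤ 1) :
    (∫ t in Set.Ioc (0:ℝ) (1 / w), (1 - Real.exp (-(w * x) / t)))
      ≤ 2 * w * Real.log (1 / w) + (1 + Real.exp 1) * w := by
  have hc : 0 ≤ w * x := mul_nonneg hw0.le hx0
  have hone : 1 ≤ 1 / w := (one_le_div hw0).2 hw1.le
  have hw : w ≤ 1 / w := hw1.le.trans hone
  have hlog : 0 ≤ Real.log (1 / w) := Real.log_nonneg hone
  have hlog_div : Real.log (1 / w / w) = 2 * Real.log (1 / w) := by
    rw [Real.log_div (by positivity) hw0.ne', one_div, Real.log_inv]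
    ring
  rw [← Set.Ioc_union_Ioc_eq_Ioc hw0.le hw,
    setIntegral_union (Set.Ioc_disjoint_Ioc_of_le le_rfl) measurableSet_Ioc
      (integrableOn_one_sub_exp_neg_div hc le_rfl) (integrableOn_one_sub_exp_neg_div hc hw0.le)]
  have hsmall := setIntegral_one_sub_exp_neg_div_le_sub hc le_rfl hw0.le
  have hlarge := setIntegral_one_sub_exp_neg_div_le_mul_log hc hw0 hw
  rw [hlog_div] at hlarge
  have hmul : w * x * (2 * Real.log (1 / w)) ≤ w * (2 * Real.log (1 / w)) :=
    mul_le_mul_of_nonneg_right (mul_le_of_le_one_right hw0.le hx1) (by positivity)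
  have hexp : 0 ≤ Real.exp 1 * w := by positivity
  linarith
end

section
/- For every β > 0 the ratio K₁/K₂ is differentiable at β and satisfies (K₁/K₂)′(β) = (3/β)(K₁/K₂)(β) + ((K₁/K₂)(β))² − 1. -/
open MeasureTheory Real Set

noncomputable section

/-- modified Bessel function of the second kind `K_i(β) = ∫₀^∞ cosh(i r) e^{-β cosh r} dr` -/
def Kb (i : ℕ) (β : ℝ) : ℝ :=
  ∫ r in Set.Ioi (0:ℝ), Real.cosh (i * r) * Real.exp (-β * Real.cosh r)

/-- The moment `∫₀^∞ coshⁿ r e^{-β cosh r} dr`. -/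
def coshMoment (n : ℕ) (β : ℝ) : ℝ :=
  ∫ r in Ioi (0:ℝ), cosh r ^ n * exp (-β * cosh r)

theorem cosh_pow_mul_exp_le (n : ℕ) {β : ℝ} (hβ : 0 < β) (r : ℝ) :
    cosh r ^ n * exp (-β * cosh r) ≤ 2 * (n + 1).factorial / β ^ (n + 1) * exp (-r) := by
  have hc : 0 < cosh r := cosh_pos r
  have hexp := Real.pow_div_factorial_le_exp (β * cosh r) (by positivity) (n + 1)
  have hr : 1 ≤ 2 * cosh r * exp (-r) := by
    have h : exp r * exp (-r) = 1 := by rw [← exp_add]; simp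
    rw [cosh_eq]
    nlinarith [mul_pos (exp_pos (-r)) (exp_pos (-r))]
  rw [neg_mul, exp_neg (β * cosh r), ← div_eq_mul_inv, div_le_iff₀ (exp_pos _)]
  calc cosh r ^ n ≤ cosh r ^ n * (2 * cosh r * exp (-r)) :=
        le_mul_of_one_le_right (by positivity) hr
    _ = 2 * (n + 1).factorial / β ^ (n + 1) * exp (-r) *
          ((β * cosh r) ^ (n + 1) / (n + 1).factorial) := by
        field_simp
        ring
    _ ≤ _ := by gcongr

theorem integrableOn_cosh_pow_mul_exp (n : ℕ) {β : ℝ} (hβ : 0 < β) :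
    IntegrableOn (fun r => cosh r ^ n * exp (-β * cosh r)) (Ioi 0) := by
  refine Integrable.mono' ((integrableOn_exp_neg_Ioi 0).const_mul _)
    (by fun_prop) (.of_forall fun r => ?_) (g := fun r =>
      2 * (n + 1).factorial / β ^ (n + 1) * exp (-r))
  have hc : 0 < cosh r := cosh_pos r
  rw [norm_of_nonneg (by positivity)]
  exact cosh_pow_mul_exp_le n hβ r

theorem hasDerivAt_coshMoment (n : ℕ) {β : ℝ} (hβ : 0 < β) :
    HasDerivAt (coshMoment n) (-coshMoment (n + 1) β) β := by
  have key := hasDerivAt_integral_of_dominated_loc_of_deriv_le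
    (μ := volume.restrict (Ioi (0:ℝ))) (x₀ := β)
    (F := fun b r => cosh r ^ n * exp (-b * cosh r))
    (F' := fun b r => -(cosh r ^ (n + 1) * exp (-b * cosh r)))
    (bound := fun r => cosh r ^ (n + 1) * exp (-(β / 2) * cosh r))
    (Ioi_mem_nhds (half_lt_self hβ))
    (.of_forall fun b => by fun_prop)
    (integrableOn_cosh_pow_mul_exp n hβ)
    (by fun_prop)
    (.of_forall fun r b hb => ?_)
    (integrableOn_cosh_pow_mul_exp (n + 1) (half_pos hβ))
    (.of_forall fun r b _ => ?_)
  · exact key.2.congr_deriv (integral_neg _)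
  · have hc : 0 < cosh r := cosh_pos r
    rw [norm_neg, norm_of_nonneg (by positivity)]
    have : β / 2 ≤ b := le_of_lt hb
    gcongr
  · have h := ((((hasDerivAt_id b).neg).mul_const (cosh r)).exp).const_mul (cosh r ^ n)
    refine h.congr_deriv ?_
    simp only [Pi.neg_apply, id]
    ring

theorem coshMoment_recurrence (n : ℕ) {β : ℝ} (hβ : 0 < β) :
    β * (coshMoment (n + 2) β - coshMoment n β) =
      (n + 1) * coshMoment (n + 1) β - n * coshMoment (n - 1) β := by
  have hint (k : ℕ) := integrableOn_cosh_pow_mul_exp k hβ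
  have hderiv : ∀ r ∈ Ici (0:ℝ), HasDerivAt
      (fun r => sinh r * (cosh r ^ n * exp (-β * cosh r)))
      ((n + 1) * (cosh r ^ (n + 1) * exp (-β * cosh r))
        - n * (cosh r ^ (n - 1) * exp (-β * cosh r))
        - β * (cosh r ^ (n + 2) * exp (-β * cosh r) - cosh r ^ n * exp (-β * cosh r))) r := by
    intro r _
    have h := (hasDerivAt_sinh r).mul
      (((hasDerivAt_cosh r).pow n).mul (((hasDerivAt_cosh r).const_mul (-β)).exp))
    refine h.congr_deriv ?_
    have hs : sinh r ^ 2 = cosh r ^ 2 - 1 := sinh_sq r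
    simp only [Pi.pow_apply, Pi.mul_apply]
    cases n with
    | zero =>
      simp
      linear_combination (-β * exp (-(β * cosh r))) * hs
    | succ m =>
      simp only [Nat.add_sub_cancel]
      push_cast
      linear_combination (((m : ℝ) + 1) * cosh r ^ m - β * cosh r ^ (m + 1)) *
        exp (-β * cosh r) * hs
  have hlim : Filter.Tendsto (fun r => sinh r * (cosh r ^ n * exp (-β * cosh r)))
      Filter.atTop (nhds 0) := by
    refine squeeze_zero_norm (a := fun r => 2 * (n + 1 + 1).factorial / β ^ (n + 1 + 1) * exp (-r))
      (fun r => ?_) ?_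
    · have hc : 0 < cosh r := cosh_pos r
      refine le_trans ?_ (cosh_pow_mul_exp_le (n + 1) hβ r)
      rw [norm_mul, norm_of_nonneg (r := cosh r ^ n * _) (by positivity), pow_succ', mul_assoc]
      gcongr
      exact abs_le_of_sq_le_sq (by rw [sinh_sq]; linarith) hc.le
    · simpa using tendsto_exp_neg_atTop_nhds_zero.const_mul
        (2 * ((n + 1 + 1).factorial : ℝ) / β ^ (n + 1 + 1))
  have hfst : IntegrableOn (fun r => ((n:ℝ) + 1) * (cosh r ^ (n + 1) * exp (-β * cosh r))
      - n * (cosh r ^ (n - 1) * exp (-β * cosh r))) (Ioi 0) :=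
    ((hint _).const_mul _).sub ((hint _).const_mul _)
  have hsnd : IntegrableOn (fun r => β * (cosh r ^ (n + 2) * exp (-β * cosh r)
      - cosh r ^ n * exp (-β * cosh r))) (Ioi 0) :=
    ((hint _).sub (hint _)).const_mul _
  have h := integral_Ioi_of_hasDerivAt_of_tendsto' hderiv (hfst.sub hsnd) hlim
  rw [integral_sub hfst hsnd, integral_sub ((hint _).const_mul _) ((hint _).const_mul _),
    integral_const_mul, integral_const_mul, integral_const_mul,
    integral_sub (hint _) (hint _)] at h
  simp only [sinh_zero, zero_mul, sub_zero] at h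
  simp only [coshMoment]
  linarith

theorem Kb_one (β : ℝ) : Kb 1 β = coshMoment 1 β := by
  simp [Kb, coshMoment]

theorem Kb_two {β : ℝ} (hβ : 0 < β) : Kb 2 β = 2 * coshMoment 2 β - coshMoment 0 β := by
  simp only [Kb, coshMoment]
  rw [← integral_const_mul, ← integral_sub ((integrableOn_cosh_pow_mul_exp 2 hβ).const_mul 2)
    (integrableOn_cosh_pow_mul_exp 0 hβ)]
  congr 1 with r
  rw [Nat.cast_ofNat, cosh_two_mul, sinh_sq]
  ring

theorem Kb_pos (i : ℕ) {β : ℝ}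
    (hint : IntegrableOn (fun r => cosh (i * r) * exp (-β * cosh r)) (Ioi 0)) : 0 < Kb i β := by
  have hpos (r : ℝ) : 0 < cosh (i * r) * exp (-β * cosh r) :=
    mul_pos (cosh_pos _) (exp_pos _)
  rw [Kb, setIntegral_pos_iff_support_of_nonneg_ae (.of_forall fun r => (hpos r).le) hint,
    Function.support_eq_univ fun r => (hpos r).ne']
  simp

theorem integrableOn_cosh_two_mul_exp {β : ℝ} (hβ : 0 < β) :
    IntegrableOn (fun r => cosh ((2 : ℕ) * r) * exp (-β * cosh r)) (Ioi 0) := by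
  refine (((integrableOn_cosh_pow_mul_exp 2 hβ).const_mul 2).sub
    (integrableOn_cosh_pow_mul_exp 0 hβ)).congr (.of_forall fun r => ?_)
  simp only [Pi.sub_apply]
  rw [Nat.cast_ofNat, cosh_two_mul, sinh_sq]
  ring

theorem hasDerivAt_Kb_one {β : ℝ} (hβ : 0 < β) :
    HasDerivAt (Kb 1) (Kb 1 β / β - Kb 2 β) β := by
  rw [show Kb 1 = coshMoment 1 from funext Kb_one, Kb_two hβ]
  refine (hasDerivAt_coshMoment 1 hβ).congr_deriv ?_
  have h := coshMoment_recurrence 0 hβ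
  norm_num at h ⊢
  field_simp
  linarith

theorem hasDerivAt_Kb_two {β : ℝ} (hβ : 0 < β) :
    HasDerivAt (Kb 2) (-Kb 1 β - 2 / β * Kb 2 β) β := by
  have hd := ((hasDerivAt_coshMoment 2 hβ).const_mul 2).sub (hasDerivAt_coshMoment 0 hβ)
  have heq : Kb 2 =ᶠ[nhds β] fun b => 2 * coshMoment 2 b - coshMoment 0 b := by
    filter_upwards [Ioi_mem_nhds hβ] with b hb using Kb_two hb
  refine (hd.congr_of_eventuallyEq heq).congr_deriv ?_
  rw [Kb_one, Kb_two hβ]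
  have h := coshMoment_recurrence 1 hβ
  norm_num at h ⊢
  field_simp
  linarith

/-- The ratio `K₁/K₂` is differentiable with
`(K₁/K₂)′(β) = (3/β)(K₁/K₂)(β) + ((K₁/K₂)(β))² − 1`. -/
theorem bessel_ratio_hasDerivAt (β : ℝ) (hβ : 0 < β) :
    HasDerivAt (fun b => Kb 1 b / Kb 2 b)
      (3 / β * (Kb 1 β / Kb 2 β) + (Kb 1 β / Kb 2 β) ^ 2 - 1) β := by
  have hK : Kb 2 β ≠ 0 := (Kb_pos 2 (integrableOn_cosh_two_mul_exp hβ)).ne'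
  refine ((hasDerivAt_Kb_one hβ).div (hasDerivAt_Kb_two hβ) hK).congr_deriv ?_
  field_simp
  ring
end
end

section
/- For every β > 0: (3/β)(K₁/K₂)(β) + ((K₁/K₂)(β))² − 1 ≥ ℓ(β), where ℓ(β) = (2−β)/(β+2)² for 0 < β < 2 and ℓ(β) = 3(6656β⁴ + 2419β³ + 726)/(128β³ + 240β² + 105β − 66)² for β ≥ 2. Moreover ℓ(β) > 0 for all β > 0. -/
open MeasureTheory Real Set

noncomputable section

/-- the lower-bound function `ℓ(β)` -/
def ellBound (β : ℝ) : ℝ :=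
  if β < 2 then (2 - β) / (β + 2) ^ 2
  else 3 * (6656 * β ^ 4 + 2419 * β ^ 3 + 726) /
    (128 * β ^ 3 + 240 * β ^ 2 + 105 * β - 66) ^ 2

open Filter Topology

lemma cosh_le_exp_of_nonneg {r : ℝ} (hr : 0 ≤ r) : cosh r ≤ exp r := by
  have h : exp (-r) ≤ exp r := exp_le_exp.2 (by linarith)
  rw [cosh_eq]
  linarith

lemma sinh_le_exp_of_nonneg {r : ℝ} (hr : 0 ≤ r) : sinh r ≤ exp r :=
  (sinh_lt_cosh r).le.trans (cosh_le_exp_of_nonneg hr)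

lemma exp_half_le_exp {r : ℝ} (hr : 0 ≤ r) : exp (r / 2) ≤ exp r :=
  exp_le_exp.2 (by linarith)

lemma tendsto_exp_pow_mul_exp_neg_mul_cosh (n : ℕ) {β : ℝ} (hβ : 0 < β) :
    Tendsto (fun r : ℝ => exp r ^ n * exp (-β * cosh r)) atTop (𝓝 0) := by
  have hexp (r : ℝ) : exp r ≤ 2 * cosh r := by
    rw [cosh_eq]
    linarith [exp_pos (-r)]
  have hcosh : Tendsto (fun r : ℝ => β * cosh r) atTop atTop := by
    refine Tendsto.const_mul_atTop hβ (tendsto_atTop_mono (fun r => ?_)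
      (tendsto_exp_atTop.const_mul_atTop (show (0 : ℝ) < 1 / 2 by norm_num)))
    linarith [hexp r]
  have hlim := ((tendsto_pow_mul_exp_neg_atTop_nhds_zero n).comp hcosh).const_mul ((2 / β) ^ n)
  rw [mul_zero] at hlim
  refine squeeze_zero (fun r => by positivity) (fun r => ?_) hlim
  calc exp r ^ n * exp (-β * cosh r)
      ≤ (2 * cosh r) ^ n * exp (-β * cosh r) := by
        gcongr
        exact hexp r
    _ = (2 / β) ^ n * ((β * cosh r) ^ n * exp (-(β * cosh r))) := by
        rw [← mul_assoc, ← mul_pow, neg_mul]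
        congr 2
        field_simp

lemma tendsto_mul_exp_neg_mul_cosh {f : ℝ → ℝ} (n : ℕ) {β : ℝ} (hβ : 0 < β)
    (hle : ∀ r, 0 ≤ r → |f r| ≤ exp r ^ n) :
    Tendsto (fun r : ℝ => f r * exp (-β * cosh r)) atTop (𝓝 0) := by
  refine squeeze_zero_norm' ?_ (tendsto_exp_pow_mul_exp_neg_mul_cosh n hβ)
  filter_upwards [eventually_ge_atTop 0] with r hr
  rw [norm_eq_abs, abs_mul, abs_exp]
  gcongr
  exact hle r hr

lemma integrableOn_mul_exp_neg_mul_cosh {f : ℝ → ℝ} (hf : Continuous f) (n : ℕ) {β : ℝ}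
    (hβ : 0 < β) (hle : ∀ r, 0 ≤ r → |f r| ≤ exp r ^ n) :
    IntegrableOn (fun r : ℝ => f r * exp (-β * cosh r)) (Ioi 0) := by
  refine integrable_of_isBigO_exp_neg one_pos (by fun_prop) ?_
  refine Asymptotics.IsBigO.of_bound 1 ?_
  filter_upwards [eventually_ge_atTop 0,
    (tendsto_exp_pow_mul_exp_neg_mul_cosh (n + 1) hβ).eventually_le_const one_pos] with r hr h1
  rw [norm_eq_abs, abs_mul, abs_exp, norm_eq_abs, abs_exp, one_mul, neg_one_mul, exp_neg,
    ← one_div, le_div_iff₀ (exp_pos r)]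
  calc |f r| * exp (-β * cosh r) * exp r
      ≤ exp r ^ n * exp (-β * cosh r) * exp r := by
        gcongr
        exact hle r hr
    _ = exp r ^ (n + 1) * exp (-β * cosh r) := by ring
    _ ≤ 1 := h1

lemma integrableOn_Kb (i : ℕ) {β : ℝ} (hβ : 0 < β) :
    IntegrableOn (fun r : ℝ => cosh (i * r) * exp (-β * cosh r)) (Ioi 0) := by
  refine integrableOn_mul_exp_neg_mul_cosh (by fun_prop) i hβ fun r hr => ?_
  rw [abs_of_pos (cosh_pos _), ← exp_nat_mul]
  exact cosh_le_exp_of_nonneg (by positivity)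

lemma Kb_pos_s14 (i : ℕ) {β : ℝ} (hβ : 0 < β) : 0 < Kb i β := by
  have hpos (r : ℝ) : 0 < cosh (i * r) * exp (-β * cosh r) :=
    mul_pos (cosh_pos _) (exp_pos _)
  refine (setIntegral_pos_iff_support_of_nonneg_ae (ae_of_all _ fun r => (hpos r).le)
    (integrableOn_Kb i hβ)).2 ?_
  have hsupp : Function.support (fun r : ℝ => cosh (i * r) * exp (-β * cosh r)) = univ :=
    eq_univ_of_forall fun r => (hpos r).ne'
  rw [hsupp, univ_inter, volume_Ioi]
  exact ENNReal.coe_lt_top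

lemma Kb_zero_le_Kb_one {β : ℝ} (hβ : 0 < β) : Kb 0 β ≤ Kb 1 β := by
  refine integral_mono (integrableOn_Kb 0 hβ) (integrableOn_Kb 1 hβ) fun r => ?_
  simp only [Nat.cast_zero, zero_mul, cosh_zero, Nat.cast_one, one_mul]
  exact le_mul_of_one_le_left (exp_pos _).le (one_le_cosh r)

lemma Kb_two_eq {β : ℝ} (hβ : 0 < β) : Kb 2 β = Kb 0 β + 2 / β * Kb 1 β := by
  have hsinh : IntegrableOn (fun r : ℝ => sinh r ^ 2 * exp (-β * cosh r)) (Ioi 0) := by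
    refine integrableOn_mul_exp_neg_mul_cosh (by fun_prop) 2 hβ fun r hr => ?_
    rw [abs_of_nonneg (sq_nonneg _)]
    have := sinh_nonneg_iff.2 hr
    gcongr
    exact sinh_le_exp_of_nonneg hr
  have hparts : Kb 1 β - β * ∫ r in Ioi (0 : ℝ), sinh r ^ 2 * exp (-β * cosh r) = 0 := by
    have h := integral_Ioi_of_hasDerivAt_of_tendsto' (a := 0) (m := 0)
      (f := fun r : ℝ => sinh r * exp (-β * cosh r))
      (f' := fun r => cosh ((1 : ℕ) * r) * exp (-β * cosh r) -
        β * (sinh r ^ 2 * exp (-β * cosh r)))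
      (fun r _ => by
        refine ((hasDerivAt_sinh r).mul ((hasDerivAt_cosh r).const_mul (-β)).exp).congr_deriv ?_
        push_cast
        rw [one_mul]
        ring)
      ((integrableOn_Kb 1 hβ).sub (hsinh.const_mul β))
      (tendsto_mul_exp_neg_mul_cosh 1 hβ fun r hr => by
        rw [abs_of_nonneg (sinh_nonneg_iff.2 hr), pow_one]
        exact sinh_le_exp_of_nonneg hr)
    rw [integral_sub (integrableOn_Kb 1 hβ) (hsinh.const_mul β), integral_const_mul] at h
    simpa [Kb] using h
  have htwo : Kb 2 β = Kb 0 β + 2 * ∫ r in Ioi (0 : ℝ), sinh r ^ 2 * exp (-β * cosh r) := by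
    rw [Kb, Kb, ← integral_const_mul, ← integral_add (integrableOn_Kb 0 hβ) (hsinh.const_mul 2)]
    congr 1 with r
    push_cast
    rw [cosh_two_mul, cosh_sq, zero_mul, cosh_zero]
    ring
  rw [htwo, sub_eq_zero.1 hparts]
  field_simp

/-- After the substitution `s = sinh (r / 2)`, a multiple of the `2k`-th moment of the Gaussian
weight `exp (-2 β s²)` on the half-line. -/
def sinhMoment (k : ℕ) (β : ℝ) : ℝ :=
  ∫ r in Ioi (0 : ℝ), cosh (r / 2) * sinh (r / 2) ^ (2 * k) * exp (-β * cosh r)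

lemma integrableOn_sinhMoment (k : ℕ) {β : ℝ} (hβ : 0 < β) :
    IntegrableOn (fun r : ℝ => cosh (r / 2) * sinh (r / 2) ^ (2 * k) * exp (-β * cosh r))
      (Ioi 0) := by
  refine integrableOn_mul_exp_neg_mul_cosh (by fun_prop) (2 * k + 1) hβ fun r hr => ?_
  have hr2 : 0 ≤ r / 2 := by positivity
  have hs := sinh_nonneg_iff.2 hr2
  have hc := (cosh_pos (r / 2)).le
  rw [abs_of_nonneg (by positivity), pow_succ']
  gcongr
  · exact (cosh_le_exp_of_nonneg hr2).trans (exp_half_le_exp hr)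
  · exact (sinh_le_exp_of_nonneg hr2).trans (exp_half_le_exp hr)

lemma cosh_eq_one_add_two_mul_sinh_half_sq (r : ℝ) : cosh r = 1 + 2 * sinh (r / 2) ^ 2 := by
  have h := cosh_two_mul (r / 2)
  rw [mul_div_cancel₀ r two_ne_zero, cosh_sq] at h
  linarith

lemma sinh_eq_two_mul_sinh_half_mul_cosh_half (r : ℝ) :
    sinh r = 2 * sinh (r / 2) * cosh (r / 2) := by
  rw [← sinh_two_mul, mul_div_cancel₀ r two_ne_zero]

lemma sinhMoment_succ (k : ℕ) {β : ℝ} (hβ : 0 < β) :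
    sinhMoment (k + 1) β = (2 * k + 1) / (4 * β) * sinhMoment k β := by
  have hk := integrableOn_sinhMoment k hβ
  have hk' := integrableOn_sinhMoment (k + 1) hβ
  have h := integral_Ioi_of_hasDerivAt_of_tendsto' (a := 0) (m := 0)
    (f := fun r : ℝ => sinh (r / 2) ^ (2 * k + 1) * exp (-β * cosh r))
    (f' := fun r => (2 * k + 1) / 2 *
        (cosh (r / 2) * sinh (r / 2) ^ (2 * k) * exp (-β * cosh r)) -
      2 * β * (cosh (r / 2) * sinh (r / 2) ^ (2 * (k + 1)) * exp (-β * cosh r)))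
    (fun r _ => by
      refine ((((hasDerivAt_id r).div_const 2).sinh.pow (2 * k + 1)).mul
        ((hasDerivAt_cosh r).const_mul (-β)).exp).congr_deriv ?_
      rw [sinh_eq_two_mul_sinh_half_mul_cosh_half r]
      simp only [id_eq, Nat.add_sub_cancel, Pi.pow_apply]
      push_cast
      ring)
    ((hk.const_mul _).sub (hk'.const_mul _))
    (tendsto_mul_exp_neg_mul_cosh (2 * k + 1) hβ fun r hr => by
      have hr2 : 0 ≤ r / 2 := by positivity
      have hs := sinh_nonneg_iff.2 hr2
      rw [abs_of_nonneg (by positivity)]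
      gcongr
      exact (sinh_le_exp_of_nonneg hr2).trans (exp_half_le_exp hr))
  rw [integral_sub (hk.const_mul _) (hk'.const_mul _), integral_const_mul,
    integral_const_mul] at h
  simp only [zero_div, sinh_zero, ne_eq, Nat.add_eq_zero_iff, one_ne_zero, and_false,
    not_false_eq_true, zero_pow, zero_mul, sub_zero] at h
  change (2 * k + 1) / 2 * sinhMoment k β - 2 * β * sinhMoment (k + 1) β = 0 at h
  field_simp
  linarith

lemma one_le_cosh_mul_poly_sinh (t : ℝ) :
    1 ≤ cosh t * (1 - sinh t ^ 2 / 2 + 3 / 8 * sinh t ^ 4) := by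
  have hc := cosh_pos t
  have hp : 0 ≤ 1 - sinh t ^ 2 / 2 + 3 / 8 * sinh t ^ 4 := by
    nlinarith [sq_nonneg (sinh t ^ 2 - 1)]
  refine (one_le_sq_iff₀ (mul_nonneg hc.le hp)).1 ?_
  rw [mul_pow, cosh_sq]
  have hx := sq_nonneg (sinh t)
  rw [show sinh t ^ 4 = (sinh t ^ 2) ^ 2 by ring]
  generalize sinh t ^ 2 = x at hx
  have h : (x + 1) * (1 - x / 2 + 3 / 8 * x ^ 2) ^ 2 - 1 =
      x ^ 3 * (40 - 15 * x + 9 * x ^ 2) / 64 := by ring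
  have h2 : 0 ≤ 40 - 15 * x + 9 * x ^ 2 := by nlinarith [sq_nonneg (x - 1)]
  have : 0 ≤ x ^ 3 * (40 - 15 * x + 9 * x ^ 2) / 64 := by positivity
  linarith

lemma cosh_mul_poly_sinh_le (t : ℝ) :
    cosh t * (1 + 3 / 2 * sinh t ^ 2 - 5 / 8 * sinh t ^ 4) ≤ 1 + 2 * sinh t ^ 2 := by
  have hc := cosh_pos t
  have hx := sq_nonneg (sinh t)
  have hc2 := cosh_sq t
  rw [show sinh t ^ 4 = (sinh t ^ 2) ^ 2 by ring]
  generalize sinh t ^ 2 = x at hx hc2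
  rcases le_or_gt (1 + 3 / 2 * x - 5 / 8 * x ^ 2) 0 with hp | hp
  · nlinarith
  · refine (sq_le_sq₀ (mul_nonneg hc.le hp.le) (by positivity)).1 ?_
    rw [mul_pow, hc2]
    have h : (1 + 2 * x) ^ 2 - (x + 1) * (1 + 3 / 2 * x - 5 / 8 * x ^ 2) ^ 2 =
        x ^ 3 * (56 + 95 * x - 25 * x ^ 2) / 64 := by ring
    have h2 : 0 ≤ 56 + 95 * x - 25 * x ^ 2 := by linarith
    have : 0 ≤ x ^ 3 * (56 + 95 * x - 25 * x ^ 2) / 64 := by positivity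
    linarith

lemma integral_sinhMoment_combination (a b c : ℝ) {β : ℝ} (hβ : 0 < β) :
    IntegrableOn (fun r : ℝ => cosh (r / 2) *
      (a + b * sinh (r / 2) ^ 2 + c * sinh (r / 2) ^ 4) * exp (-β * cosh r)) (Ioi 0) ∧
    ∫ r in Ioi (0 : ℝ), cosh (r / 2) *
      (a + b * sinh (r / 2) ^ 2 + c * sinh (r / 2) ^ 4) * exp (-β * cosh r) =
      (a + b / (4 * β) + 3 * c / (16 * β ^ 2)) * sinhMoment 0 β := by
  have h0 := (integrableOn_sinhMoment 0 hβ).const_mul a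
  have h1 := (integrableOn_sinhMoment 1 hβ).const_mul b
  have h2 := (integrableOn_sinhMoment 2 hβ).const_mul c
  have h01 := h0.add h1
  have heq : (fun r : ℝ => cosh (r / 2) *
      (a + b * sinh (r / 2) ^ 2 + c * sinh (r / 2) ^ 4) * exp (-β * cosh r)) = fun r =>
      a * (cosh (r / 2) * sinh (r / 2) ^ (2 * 0) * exp (-β * cosh r)) +
      b * (cosh (r / 2) * sinh (r / 2) ^ (2 * 1) * exp (-β * cosh r)) +
      c * (cosh (r / 2) * sinh (r / 2) ^ (2 * 2) * exp (-β * cosh r)) := by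
    ext r
    ring
  rw [heq]
  refine ⟨h01.add h2, ?_⟩
  rw [integral_add (by exact h01) h2, integral_add h0 h1, integral_const_mul, integral_const_mul,
    integral_const_mul]
  change a * sinhMoment 0 β + b * sinhMoment (0 + 1) β + c * sinhMoment (1 + 1) β = _
  rw [sinhMoment_succ 1 hβ, show sinhMoment 1 β = sinhMoment (0 + 1) β from rfl,
    sinhMoment_succ 0 hβ]
  push_cast
  field_simp
  ring

lemma Kb_zero_le {β : ℝ} (hβ : 0 < β) :
    Kb 0 β ≤ (1 - 1 / (8 * β) + 9 / (128 * β ^ 2)) * sinhMoment 0 β := by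
  obtain ⟨hint, heq⟩ := integral_sinhMoment_combination 1 (-1 / 2) (3 / 8) hβ
  have h : Kb 0 β ≤ _ := integral_mono (integrableOn_Kb 0 hβ) hint fun r => by
    have := one_le_cosh_mul_poly_sinh (r / 2)
    simp only [Nat.cast_zero, zero_mul, cosh_zero]
    gcongr
    linarith
  rw [heq] at h
  convert h using 2
  field_simp
  ring

lemma le_Kb_one {β : ℝ} (hβ : 0 < β) :
    (1 + 3 / (8 * β) - 15 / (128 * β ^ 2)) * sinhMoment 0 β ≤ Kb 1 β := by
  obtain ⟨hint, heq⟩ := integral_sinhMoment_combination 1 (3 / 2) (-5 / 8) hβ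
  have h : _ ≤ Kb 1 β := integral_mono hint (integrableOn_Kb 1 hβ) fun r => by
    have := cosh_mul_poly_sinh_le (r / 2)
    simp only [Nat.cast_one, one_mul]
    gcongr
    rw [cosh_eq_one_add_two_mul_sinh_half_sq r]
    linarith
  rw [heq] at h
  convert h using 2
  field_simp
  ring

lemma sinhMoment_zero_nonneg (β : ℝ) : 0 ≤ sinhMoment 0 β :=
  integral_nonneg fun r => by
    have := cosh_pos (r / 2)
    simp only [mul_zero, pow_zero, mul_one, Pi.zero_apply]
    positivity

lemma Kb_zero_mul_le {β : ℝ} (hβ : 2 ≤ β) :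
    (128 * β ^ 2 + 48 * β - 33) * Kb 0 β ≤ (128 * β ^ 2 - 16 * β + 9) * Kb 1 β := by
  have hβ0 : 0 < β := by linarith
  have hM := sinhMoment_zero_nonneg β
  have hq : 0 < 128 * β ^ 2 - 16 * β + 9 := by nlinarith
  have hp : 0 < 128 * β ^ 2 + 48 * β - 33 := by nlinarith
  calc (128 * β ^ 2 + 48 * β - 33) * Kb 0 β
      ≤ (128 * β ^ 2 + 48 * β - 33) *
        ((1 - 1 / (8 * β) + 9 / (128 * β ^ 2)) * sinhMoment 0 β) := by
        gcongr
        exact Kb_zero_le hβ0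
    _ = (128 * β ^ 2 - 16 * β + 9) *
        ((1 + 3 / (8 * β) - 33 / (128 * β ^ 2)) * sinhMoment 0 β) := by
        field_simp
        ring
    _ ≤ (128 * β ^ 2 - 16 * β + 9) *
        ((1 + 3 / (8 * β) - 15 / (128 * β ^ 2)) * sinhMoment 0 β) := by
        gcongr
        norm_num
    _ ≤ (128 * β ^ 2 - 16 * β + 9) * Kb 1 β := by
        gcongr
        exact le_Kb_one hβ0

/-- A bound `K₀ / K₁ ≤ q / p` gives `K₁ / K₂ ≥ β p / (β q + 2 p)`, and the quantity to be bounded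
is increasing in `K₁ / K₂`. -/
lemma le_of_Kb_zero_mul_le {β p q d : ℝ} (hβ : 0 < β) (hp : 0 < p) (hq : 0 < q)
    (hd : d = β * q + 2 * p) (h : p * Kb 0 β ≤ q * Kb 1 β) :
    (3 * p * d + (β * p) ^ 2 - d ^ 2) / d ^ 2 ≤
      3 / β * (Kb 1 β / Kb 2 β) + (Kb 1 β / Kb 2 β) ^ 2 - 1 := by
  have hd0 : 0 < d := by
    rw [hd]
    positivity
  have hratio : β * p / d ≤ Kb 1 β / Kb 2 β := by
    rw [div_le_div_iff₀ hd0 (Kb_pos_s14 2 hβ), Kb_two_eq hβ, hd]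
    have h' := mul_le_mul_of_nonneg_left h hβ.le
    field_simp
    linarith
  calc (3 * p * d + (β * p) ^ 2 - d ^ 2) / d ^ 2
      = 3 / β * (β * p / d) + (β * p / d) ^ 2 - 1 := by field_simp
    _ ≤ 3 / β * (Kb 1 β / Kb 2 β) + (Kb 1 β / Kb 2 β) ^ 2 - 1 := by gcongr

/-- `(3/β)(K₁/K₂)(β) + ((K₁/K₂)(β))² − 1 ≥ ℓ(β) > 0`. -/
theorem bessel_ratio_derivative_lower_bound (β : ℝ) (hβ : 0 < β) :
    3 / β * (Kb 1 β / Kb 2 β) + (Kb 1 β / Kb 2 β) ^ 2 - 1 ≥ ellBound β ∧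
    0 < ellBound β := by
  rw [ellBound]
  split_ifs with h2
  · have h2' : 0 < 2 - β := by linarith
    refine ⟨?_, by positivity⟩
    have h := le_of_Kb_zero_mul_le (d := β + 2) hβ one_pos one_pos (by ring)
      (by simpa using Kb_zero_le_Kb_one hβ)
    convert h using 2
    ring
  · have h2' : 2 ≤ β := not_lt.1 h2
    have hp : 0 < 128 * β ^ 2 + 48 * β - 33 := by nlinarith
    have hq : 0 < 128 * β ^ 2 - 16 * β + 9 := by nlinarith
    have hd : 0 < 128 * β ^ 3 + 240 * β ^ 2 + 105 * β - 66 := by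
      nlinarith [pow_pos hβ 3, pow_pos hβ 2]
    refine ⟨?_, by positivity⟩
    refine le_trans ?_ (le_of_Kb_zero_mul_le
      (d := 128 * β ^ 3 + 240 * β ^ 2 + 105 * β - 66) hβ hp hq (by ring) (Kb_zero_mul_le h2'))
    have hdiff : 0 ≤ β * (18279 * β ^ 2 - 12240 * β - 6039) :=
      mul_nonneg hβ.le (by nlinarith)
    gcongr
    linarith
end
end

section
/- The function β ↦ K₁(β)/K₂(β) is strictly increasing on (0,∞), and 0 < K₁(β)/K₂(β) < 1 for every β > 0. -/
open MeasureTheory Real Set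

noncomputable section

/-- A nonnegative integrable function on `(0,∞)` that is eventually positive has positive
integral. -/
lemma setIntegral_Ioi_pos_of_eventually_pos {f : ℝ → ℝ} (hf : IntegrableOn f (Ioi 0))
    (h0 : ∀ r ∈ Ioi (0:ℝ), 0 ≤ f r) {R : ℝ} (hR : 0 ≤ R) (hpos : ∀ r, R < r → 0 < f r) :
    0 < ∫ r in Ioi (0:ℝ), f r := by
  rw [setIntegral_pos_iff_support_of_nonneg_ae
    ((ae_restrict_iff' measurableSet_Ioi).2 (Filter.Eventually.of_forall h0)) hf]
  have hsub : Ioi R ⊆ Function.support f ∩ Ioi 0 := fun r hr =>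
    ⟨(hpos r hr).ne', lt_of_le_of_lt hR hr⟩
  exact lt_of_lt_of_le (by simp) (measure_mono hsub)

lemma cosh_le_cosh_two_mul (r : ℝ) : Real.cosh r ≤ Real.cosh (2 * r) := by
  rw [Real.cosh_le_cosh, abs_mul]
  norm_num
  linarith [abs_nonneg r]

lemma cosh_two_mul_eq (r : ℝ) : Real.cosh (2 * r) = 2 * Real.cosh r ^ 2 - 1 := by
  rw [Real.cosh_two_mul, Real.sinh_sq]
  ring

lemma integrableOn_cosh_two_mul_mul_exp {β : ℝ} (hβ : 0 < β) :
    IntegrableOn (fun r => Real.cosh (2 * r) * Real.exp (-β * Real.cosh r)) (Ioi 0) := by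
  refine integrable_of_isBigO_exp_neg (b := 1) one_pos
    (Continuous.continuousOn (by fun_prop)) ?_
  refine Asymptotics.IsBigO.of_bound (24 / β ^ 3) (Filter.Eventually.of_forall fun r => ?_)
  have hc : 0 < Real.cosh r := Real.cosh_pos r
  rw [Real.norm_of_nonneg (by positivity), Real.norm_of_nonneg (by positivity)]
  have hexp : Real.exp r ≤ 2 * Real.cosh r := by
    rw [Real.cosh_eq]
    linarith [Real.exp_pos (-r)]
  have hpow : β ^ 3 * Real.cosh r ^ 3 ≤ 6 * Real.exp (β * Real.cosh r) := by
    have h := Real.pow_div_factorial_le_exp (β * Real.cosh r) (by positivity) 3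
    norm_num [Nat.factorial] at h
    rw [mul_pow] at h
    linarith
  rw [cosh_two_mul_eq, neg_mul, neg_mul, one_mul, Real.exp_neg, Real.exp_neg,
    ← div_eq_mul_inv, ← div_eq_mul_inv, div_div, div_le_div_iff₀ (by positivity) (by positivity)]
  have hcube : (2 * Real.cosh r ^ 2 - 1) * Real.exp r ≤ 4 * Real.cosh r ^ 3 :=
    calc (2 * Real.cosh r ^ 2 - 1) * Real.exp r
        ≤ (2 * Real.cosh r ^ 2) * Real.exp r := by gcongr; linarith
      _ ≤ (2 * Real.cosh r ^ 2) * (2 * Real.cosh r) := by gcongr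
      _ = 4 * Real.cosh r ^ 3 := by ring
  have h3 := mul_le_mul_of_nonneg_right hcube (pow_pos hβ 3).le
  linarith

lemma integrableOn_cosh_mul_exp {β : ℝ} (hβ : 0 < β) :
    IntegrableOn (fun r => Real.cosh r * Real.exp (-β * Real.cosh r)) (Ioi 0) := by
  refine (integrableOn_cosh_two_mul_mul_exp hβ).mono'
    (Continuous.aestronglyMeasurable (by fun_prop)) (Filter.Eventually.of_forall fun r => ?_)
  have hc : 0 < Real.cosh r := Real.cosh_pos r
  rw [Real.norm_of_nonneg (by positivity)]
  gcongr
  exact cosh_le_cosh_two_mul r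

lemma Kb_one_s15 (β : ℝ) :
    Kb 1 β = ∫ r in Ioi (0:ℝ), Real.cosh r * Real.exp (-β * Real.cosh r) := by
  simp [Kb]

lemma Kb_two_s15 (β : ℝ) :
    Kb 2 β = ∫ r in Ioi (0:ℝ), Real.cosh (2 * r) * Real.exp (-β * Real.cosh r) := by
  simp [Kb]

lemma Kb_one_pos {β : ℝ} (hβ : 0 < β) : 0 < Kb 1 β := by
  have hpos (r : ℝ) : 0 < Real.cosh r * Real.exp (-β * Real.cosh r) :=
    mul_pos (Real.cosh_pos r) (Real.exp_pos _)
  rw [Kb_one_s15]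
  exact setIntegral_Ioi_pos_of_eventually_pos (integrableOn_cosh_mul_exp hβ)
    (fun r _ => (hpos r).le) le_rfl fun r _ => hpos r

lemma Kb_one_lt_Kb_two {β : ℝ} (hβ : 0 < β) : Kb 1 β < Kb 2 β := by
  rw [← sub_pos, Kb_one_s15, Kb_two_s15,
    ← integral_sub (integrableOn_cosh_two_mul_mul_exp hβ) (integrableOn_cosh_mul_exp hβ)]
  have hpos : ∀ r : ℝ, 0 < r → 0 < Real.cosh (2 * r) * Real.exp (-β * Real.cosh r) -
      Real.cosh r * Real.exp (-β * Real.cosh r) := fun r hr => by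
    have hlt : Real.cosh r < Real.cosh (2 * r) := by
      rw [Real.cosh_lt_cosh, abs_of_pos hr, abs_of_pos (by linarith)]
      linarith
    exact sub_pos.2 (mul_lt_mul_of_pos_right hlt (Real.exp_pos _))
  exact setIntegral_Ioi_pos_of_eventually_pos
    ((integrableOn_cosh_two_mul_mul_exp hβ).sub (integrableOn_cosh_mul_exp hβ))
    (fun r hr => (hpos r hr).le) le_rfl hpos

/-- On the positive axis `c ↦ c - q (2 c ^ 2 - 1)` changes sign exactly once, from positive to
negative. -/
lemma exists_factorization_sub_mul {q : ℝ} (hq : 0 < q) :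
    ∃ c₀ d : ℝ, 0 < c₀ ∧ 0 < d ∧
      ∀ c : ℝ, c - q * (2 * c ^ 2 - 1) = 2 * q * (c₀ - c) * (c + d) := by
  have hs : 1 < √(1 + 8 * q ^ 2) := by
    rw [Real.lt_sqrt zero_le_one]
    nlinarith [pow_pos hq 2]
  have hsq : √(1 + 8 * q ^ 2) ^ 2 = 1 + 8 * q ^ 2 := Real.sq_sqrt (by positivity)
  generalize √(1 + 8 * q ^ 2) = s at hs hsq
  refine ⟨(s + 1) / (4 * q), (s - 1) / (4 * q),
    div_pos (by linarith) (by positivity), div_pos (by linarith) (by positivity), fun c => ?_⟩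
  field_simp
  linear_combination -2 * hsq

/-- If `K₁ - q K₂` vanishes at `a`, then it is positive beyond `a`. -/
lemma mul_Kb_two_lt_Kb_one {a b q : ℝ} (ha : 0 < a) (hab : a < b) (hq : 0 < q)
    (h : Kb 1 a = q * Kb 2 a) : q * Kb 2 b < Kb 1 b := by
  obtain ⟨c₀, d, hc₀, hd, hfac⟩ := exists_factorization_sub_mul hq
  have hint {β : ℝ} (hβ : 0 < β) : IntegrableOn (fun r =>
      Real.cosh r * Real.exp (-β * Real.cosh r) -
        q * (Real.cosh (2 * r) * Real.exp (-β * Real.cosh r))) (Ioi 0) :=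
    (integrableOn_cosh_mul_exp hβ).sub ((integrableOn_cosh_two_mul_mul_exp hβ).const_mul q)
  have hval {β : ℝ} (hβ : 0 < β) : ∫ r in Ioi (0:ℝ),
      (Real.cosh r * Real.exp (-β * Real.cosh r) -
        q * (Real.cosh (2 * r) * Real.exp (-β * Real.cosh r))) = Kb 1 β - q * Kb 2 β := by
    rw [integral_sub (integrableOn_cosh_mul_exp hβ)
      ((integrableOn_cosh_two_mul_mul_exp hβ).const_mul q), integral_const_mul, Kb_one_s15, Kb_two_s15]
  have hb : 0 < b := ha.trans hab
  set E := Real.exp (-(b - a) * c₀)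
  have heq (r : ℝ) : Real.cosh r * Real.exp (-b * Real.cosh r) -
        q * (Real.cosh (2 * r) * Real.exp (-b * Real.cosh r)) -
      E * (Real.cosh r * Real.exp (-a * Real.cosh r) -
        q * (Real.cosh (2 * r) * Real.exp (-a * Real.cosh r))) =
      2 * q * (Real.cosh r + d) * Real.exp (-a * Real.cosh r) *
        ((c₀ - Real.cosh r) * (Real.exp (-(b - a) * Real.cosh r) - E)) := by
    have hexp : Real.exp (-b * Real.cosh r) =
        Real.exp (-a * Real.cosh r) * Real.exp (-(b - a) * Real.cosh r) := by
      rw [← Real.exp_add]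
      ring_nf
    rw [hexp, cosh_two_mul_eq]
    linear_combination Real.exp (-a * Real.cosh r) *
      (Real.exp (-(b - a) * Real.cosh r) - E) * hfac (Real.cosh r)
  have hfactor (r : ℝ) : 0 < 2 * q * (Real.cosh r + d) * Real.exp (-a * Real.cosh r) := by
    have := Real.cosh_pos r
    positivity
  have hlt : 0 < ∫ r in Ioi (0:ℝ), (Real.cosh r * Real.exp (-b * Real.cosh r) -
        q * (Real.cosh (2 * r) * Real.exp (-b * Real.cosh r)) -
      E * (Real.cosh r * Real.exp (-a * Real.cosh r) -
        q * (Real.cosh (2 * r) * Real.exp (-a * Real.cosh r)))) := by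
    refine setIntegral_Ioi_pos_of_eventually_pos ((hint hb).sub ((hint ha).const_mul E))
      (fun r _ => ?_) hc₀.le fun r hr => ?_
    · rw [heq]
      refine mul_nonneg (hfactor r).le ?_
      rcases le_total (Real.cosh r) c₀ with hc | hc
      · exact mul_nonneg (sub_nonneg.2 hc) (sub_nonneg.2 (Real.exp_le_exp.2 (by nlinarith)))
      · exact mul_nonneg_of_nonpos_of_nonpos (sub_nonpos.2 hc)
          (sub_nonpos.2 (Real.exp_le_exp.2 (by nlinarith)))
    · rw [heq]
      have hc : c₀ < Real.cosh r := hr.trans_le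
        ((Real.self_le_sinh_iff.2 (hc₀.trans hr).le).trans (Real.sinh_lt_cosh r).le)
      exact mul_pos (hfactor r) (mul_pos_of_neg_of_neg (sub_neg.2 hc)
        (sub_neg.2 (Real.exp_lt_exp.2 (by nlinarith))))
  rw [integral_sub (hint hb) ((hint ha).const_mul E), integral_const_mul, hval hb, hval ha, h]
    at hlt
  linarith

/-- `β ↦ K₁(β)/K₂(β)` is strictly increasing on `(0,∞)` and takes
values in `(0,1)`. -/
theorem bessel_ratio_strictMono_and_range :
    StrictMonoOn (fun β => Kb 1 β / Kb 2 β) (Set.Ioi (0:ℝ)) ∧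
    ∀ β : ℝ, 0 < β → 0 < Kb 1 β / Kb 2 β ∧ Kb 1 β / Kb 2 β < 1 := by
  constructor
  · intro a ha b hb hab
    have ha2 : 0 < Kb 2 a := (Kb_one_pos ha).trans (Kb_one_lt_Kb_two ha)
    have hb2 : 0 < Kb 2 b := (Kb_one_pos hb).trans (Kb_one_lt_Kb_two hb)
    exact (lt_div_iff₀ hb2).2 (mul_Kb_two_lt_Kb_one ha hab (div_pos (Kb_one_pos ha) ha2)
      (div_mul_cancel₀ _ ha2.ne').symm)
  · intro β hβ
    have hβ2 : 0 < Kb 2 β := (Kb_one_pos hβ).trans (Kb_one_lt_Kb_two hβ)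
    exact ⟨div_pos (Kb_one_pos hβ) hβ2, (div_lt_one hβ2).2 (Kb_one_lt_Kb_two hβ)⟩
end
end

section
/- Let 0 < a_l ≤ a_u and let f, g ∈ L¹(ℝ³) be nonnegative with n_f ≥ a_l, n_g ≥ a_l, ∫_{ℝ³} f dq ≤ a_u and ∫_{ℝ³} g dq ≤ a_u. Then |n_f − n_g| ≤ (4 a_u / a_l) ∫_{ℝ³} |f − g| dq. -/
open MeasureTheory Real Set

noncomputable section

lemma abs_coord_div_q0_le_one (i : Fin 3) (q : E3) : |q i / q0 q| ≤ 1 := by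
  rw [abs_div, abs_of_pos (q0_pos q), div_le_one (q0_pos q)]
  refine (PiLp.norm_apply_le q i).trans (Real.le_sqrt_of_sq_le ?_)
  linarith

lemma abs_integral_mul_coord_sub_le {f g : E3 → ℝ} (hf : Integrable f) (hg : Integrable g)
    (i : Fin 3) :
    |(∫ q, f q * (q i / q0 q)) - ∫ q, g q * (q i / q0 q)| ≤ ∫ q, |f q - g q| := by
  rw [← integral_sub (integrable_mul_coord_div_q0 hf i) (integrable_mul_coord_div_q0 hg i)]
  refine abs_integral_le_integral_abs.trans (integral_mono_of_nonneg
    (.of_forall fun q => abs_nonneg _) (hf.sub hg).abs (.of_forall fun q => ?_))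
  change |f q * (q i / q0 q) - g q * (q i / q0 q)| ≤ |f q - g q|
  rw [← sub_mul, abs_mul]
  exact mul_le_of_le_one_right (abs_nonneg _) (abs_coord_div_q0_le_one i q)

lemma sum_abs_le_two_mul {A : ℝ} (hA : 0 ≤ A) {a : Fin 3 → ℝ} (h : ∑ i, a i ^ 2 ≤ A ^ 2) :
    ∑ i, |a i| ≤ 2 * A := by
  have hcs := sq_sum_le_card_mul_sum_sq (s := Finset.univ) (f := fun i => |a i|)
  simp only [sq_abs, Finset.card_univ, Fintype.card_fin] at hcs
  push_cast at hcs
  refine abs_le_of_sq_le_sq' ?_ (by positivity) |>.2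
  nlinarith

lemma abs_minkowski_sq_sub_le {A B D : ℝ} {a b : Fin 3 → ℝ} (hA : 0 ≤ A) (hB : 0 ≤ B)
    (ha : ∑ i, a i ^ 2 ≤ A ^ 2) (hb : ∑ i, b i ^ 2 ≤ B ^ 2)
    (hAB : |A - B| ≤ D) (hab : ∀ i, |a i - b i| ≤ D) :
    |(A ^ 2 - ∑ i, a i ^ 2) - (B ^ 2 - ∑ i, b i ^ 2)| ≤ 3 * (A + B) * D := by
  have hD : 0 ≤ D := (abs_nonneg _).trans hAB
  have htime : |A ^ 2 - B ^ 2| ≤ (A + B) * D := by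
    rw [sq_sub_sq, abs_mul, abs_of_nonneg (add_nonneg hA hB)]
    gcongr
  have hspace : |∑ i, a i ^ 2 - ∑ i, b i ^ 2| ≤ 2 * (A + B) * D := calc
    _ = |∑ i, (a i + b i) * (a i - b i)| := by
      rw [← Finset.sum_sub_distrib]; simp only [sq_sub_sq]
    _ ≤ ∑ i, (|a i| + |b i|) * D := by
      refine (Finset.abs_sum_le_sum_abs _ _).trans (Finset.sum_le_sum fun i _ => ?_)
      rw [abs_mul]
      gcongr
      · exact abs_add_le _ _
      · exact hab i
    _ = (∑ i, |a i| + ∑ i, |b i|) * D := by rw [← Finset.sum_mul, Finset.sum_add_distrib]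
    _ ≤ 2 * (A + B) * D := by
      gcongr
      linarith [sum_abs_le_two_mul hA ha, sum_abs_le_two_mul hB hb]
  calc
    _ = |(A ^ 2 - B ^ 2) - (∑ i, a i ^ 2 - ∑ i, b i ^ 2)| := by congr 1; ring
    _ ≤ _ := abs_sub _ _
    _ ≤ _ := by linarith

/-- Lipschitz estimate for the proper particle density:
`|n_f − n_g| ≤ (4a_u/a_l)‖f−g‖_{L¹}`. -/
theorem nDens_lipschitz (a_l a_u : ℝ) (hal : 0 < a_l) (hala : a_l ≤ a_u)
    (f g : E3 → ℝ) (hf : Integrable f) (hg : Integrable g)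
    (hf0 : ∀ q, 0 ≤ f q) (hg0 : ∀ q, 0 ≤ g q)
    (hnf : a_l ≤ nDens f) (hng : a_l ≤ nDens g)
    (hfu : (∫ q, f q) ≤ a_u) (hgu : (∫ q, g q) ≤ a_u) :
    |nDens f - nDens g| ≤ 4 * a_u / a_l * ∫ q, |f q - g q| := by
  have hf' := Real.sqrt_pos.1 (hal.trans_le hnf)
  have hg' := Real.sqrt_pos.1 (hal.trans_le hng)
  have hAB : |(∫ q, f q) - ∫ q, g q| ≤ ∫ q, |f q - g q| := by
    rw [← integral_sub hf hg]
    exact abs_integral_le_integral_abs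
  have hsq := abs_minkowski_sq_sub_le (integral_nonneg hf0) (integral_nonneg hg0)
    (sub_pos.1 hf').le (sub_pos.1 hg').le hAB (abs_integral_mul_coord_sub_le hf hg)
  rw [← Real.sq_sqrt hf'.le, ← Real.sq_sqrt hg'.le] at hsq
  change |nDens f ^ 2 - nDens g ^ 2| ≤ _ at hsq
  have hD : 0 ≤ ∫ q, |f q - g q| := (abs_nonneg _).trans hAB
  rw [sq_sub_sq, abs_mul, abs_of_nonneg (by linarith)] at hsq
  have hlow : 2 * a_l * |nDens f - nDens g| ≤ (nDens f + nDens g) * |nDens f - nDens g| := by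
    gcongr
    linarith
  have hup : 3 * ((∫ q, f q) + ∫ q, g q) * ∫ q, |f q - g q|
      ≤ 8 * a_u * ∫ q, |f q - g q| :=
    mul_le_mul_of_nonneg_right (by linarith) hD
  rw [div_mul_eq_mul_div, le_div_iff₀ hal]
  linarith
end
end

section
/- Let 0 < a_l ≤ a_u and let f, g ∈ L¹(ℝ³) be nonnegative with n_f ≥ a_l, n_g ≥ a_l, ∫_{ℝ³} f dq ≤ a_u and ∫_{ℝ³} g dq ≤ a_u. Then |u_f − u_g| ≤ (√2 a_u / a_l² + 8 a_u² / a_l³) ∫_{ℝ³} |f − g| dq. -/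
open MeasureTheory Real Set

noncomputable section

lemma norm_inv_q0_smul_le_one (q : E3) : ‖(q0 q)⁻¹ • q‖ ≤ 1 := by
  rw [norm_smul, norm_inv, Real.norm_of_nonneg (q0_pos q).le, inv_mul_le_one₀ (q0_pos q)]
  exact Real.le_sqrt_of_sq_le (by linarith)

lemma norm_smul_inv_q0_smul_le (f : E3 → ℝ) (q : E3) : ‖f q • ((q0 q)⁻¹ • q)‖ ≤ |f q| := by
  rw [norm_smul, Real.norm_eq_abs]
  exact mul_le_of_le_one_right (abs_nonneg _) (norm_inv_q0_smul_le_one q)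

lemma MeasureTheory.Integrable.smul_inv_q0_smul {f : E3 → ℝ} (hf : Integrable f) :
    Integrable (fun q => f q • ((q0 q)⁻¹ • q)) := by
  refine hf.mono (hf.aestronglyMeasurable.smul ?_) (.of_forall (norm_smul_inv_q0_smul_le f))
  exact ((continuous_q0.inv₀ fun q => (q0_pos q).ne').smul continuous_id).aestronglyMeasurable

lemma norm_integral_smul_inv_q0_smul_le {f : E3 → ℝ} (hf : Integrable f) :
    ‖∫ q, f q • ((q0 q)⁻¹ • q)‖ ≤ ∫ q, |f q| :=
  norm_integral_le_of_norm_le hf.abs (.of_forall (norm_smul_inv_q0_smul_le f))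

lemma nDens_eq {f : E3 → ℝ} (hf : Integrable f) :
    nDens f = Real.sqrt ((∫ q, f q) ^ 2 - ‖∫ q, f q • ((q0 q)⁻¹ • q)‖ ^ 2) := by
  rw [nDens, EuclideanSpace.real_norm_sq_eq]
  congr 3 with i
  have h := (EuclideanSpace.proj (𝕜 := ℝ) i).integral_comp_comm hf.smul_inv_q0_smul
  simp only [PiLp.proj_apply, PiLp.smul_apply, smul_eq_mul] at h
  rw [← h]
  simp only [div_eq_inv_mul]

lemma nDens_sq {f : E3 → ℝ} (hf : Integrable f) (hf0 : ∀ q, 0 ≤ f q) :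
    nDens f ^ 2 = (∫ q, f q) ^ 2 - ‖∫ q, f q • ((q0 q)⁻¹ • q)‖ ^ 2 := by
  rw [nDens_eq hf, Real.sq_sqrt]
  have h := norm_integral_smul_inv_q0_smul_le hf
  simp only [abs_of_nonneg (hf0 _)] at h
  exact sub_nonneg.2 (pow_le_pow_left₀ (norm_nonneg _) h 2)

lemma abs_sq_sub_sq_le {x y c d : ℝ} (hx : 0 ≤ x) (hy : 0 ≤ y) (hxc : x ≤ c) (hyc : y ≤ c)
    (hd : |x - y| ≤ d) : |x ^ 2 - y ^ 2| ≤ 2 * c * d := by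
  rw [sq_sub_sq, abs_mul, abs_of_nonneg (add_nonneg hx hy)]
  exact mul_le_mul (by linarith) hd (abs_nonneg _) (by linarith)

lemma norm_inv_smul_sub_inv_smul_le {E : Type*} [SeminormedAddCommGroup E] [NormedSpace ℝ E]
    {v w : E} {m n a c d : ℝ} (ha : 0 < a) (hm : a ≤ m) (hn : a ≤ n) (hw : ‖w‖ ≤ c)
    (hvw : ‖v - w‖ ≤ d) :
    ‖m⁻¹ • v - n⁻¹ • w‖ ≤ d / a + c * |m - n| / a ^ 2 := by
  have hm0 := ha.trans_le hm
  have hn0 := ha.trans_le hn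
  have hd : 0 ≤ d := (norm_nonneg _).trans hvw
  have hc : 0 ≤ c := (norm_nonneg _).trans hw
  have key : m⁻¹ • v - n⁻¹ • w = m⁻¹ • (v - w) + (m⁻¹ - n⁻¹) • w := by
    rw [smul_sub, sub_smul]; abel
  rw [key]
  refine (norm_add_le _ _).trans (add_le_add ?_ ?_)
  · rw [norm_smul, norm_inv, Real.norm_of_nonneg hm0.le, ← div_eq_inv_mul]
    gcongr
  · rw [norm_smul, inv_sub_inv hm0.ne' hn0.ne', norm_div, Real.norm_eq_abs, Real.norm_eq_abs,
      abs_sub_comm, abs_of_pos (mul_pos hm0 hn0), div_mul_eq_mul_div, mul_comm |m - n|, sq]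
    gcongr

/-- Lipschitz estimate for the velocity:
`|u_f − u_g| ≤ (√2 a_u/a_l² + 8a_u²/a_l³)‖f−g‖_{L¹}`. -/
theorem uVel_lipschitz (a_l a_u : ℝ) (hal : 0 < a_l) (hala : a_l ≤ a_u)
    (f g : E3 → ℝ) (hf : Integrable f) (hg : Integrable g)
    (hf0 : ∀ q, 0 ≤ f q) (hg0 : ∀ q, 0 ≤ g q)
    (hnf : a_l ≤ nDens f) (hng : a_l ≤ nDens g)
    (hfu : (∫ q, f q) ≤ a_u) (hgu : (∫ q, g q) ≤ a_u) :
    ‖uVel f - uVel g‖ ≤ (Real.sqrt 2 * a_u / a_l ^ 2 + 8 * a_u ^ 2 / a_l ^ 3) *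
      ∫ q, |f q - g q| := by
  set D := ∫ q, |f q - g q| with hD
  set A := ∫ q, f q with hA
  set B := ∫ q, g q with hB
  set V := ∫ q, f q • ((q0 q)⁻¹ • q) with hV
  set W := ∫ q, g q • ((q0 q)⁻¹ • q) with hW
  have hA0 : 0 ≤ A := integral_nonneg hf0
  have hB0 : 0 ≤ B := integral_nonneg hg0
  have hAB : |A - B| ≤ D := by
    rw [hA, hB, ← integral_sub hf hg]
    exact abs_integral_le_integral_abs
  have hVW : ‖V - W‖ ≤ D := by
    rw [hV, hW, ← integral_sub hf.smul_inv_q0_smul hg.smul_inv_q0_smul]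
    simpa only [Pi.sub_apply, sub_smul] using norm_integral_smul_inv_q0_smul_le (hf.sub hg)
  have hVA : ‖V‖ ≤ a_u := by
    refine le_trans ?_ hfu
    simpa only [abs_of_nonneg (hf0 _)] using norm_integral_smul_inv_q0_smul_le hf
  have hWB : ‖W‖ ≤ a_u := by
    refine le_trans ?_ hgu
    simpa only [abs_of_nonneg (hg0 _)] using norm_integral_smul_inv_q0_smul_le hg
  have hD0 : 0 ≤ D := (abs_nonneg _).trans hAB
  have hau : 0 < a_u := hal.trans_le hala
  have hn : |nDens f - nDens g| ≤ 2 * a_u * D / a_l := by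
    have h1 := abs_sq_sub_sq_le hA0 hB0 hfu hgu hAB
    have h2 := abs_sq_sub_sq_le (norm_nonneg V) (norm_nonneg W) hVA hWB
      ((abs_norm_sub_norm_le V W).trans hVW)
    have h3 : |nDens f ^ 2 - nDens g ^ 2| ≤ 4 * a_u * D := by
      rw [nDens_sq hf hf0, nDens_sq hg hg0, sub_sub_sub_comm]
      exact (abs_sub _ _).trans (by linarith)
    rw [sq_sub_sq, abs_mul, abs_of_pos (by linarith)] at h3
    rw [le_div_iff₀ hal]
    have h4 := mul_le_mul_of_nonneg_right (add_le_add hnf hng) (abs_nonneg (nDens f - nDens g))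
    linarith
  have h2 : 1 ≤ √2 := Real.one_le_sqrt.2 one_le_two
  calc ‖uVel f - uVel g‖ ≤ D / a_l + a_u * |nDens f - nDens g| / a_l ^ 2 :=
        norm_inv_smul_sub_inv_smul_le hal hnf hng hWB hVW
    _ ≤ D / a_l + a_u * (2 * a_u * D / a_l) / a_l ^ 2 := by gcongr
    _ = (1 * a_l / a_l ^ 2 + 2 * a_u ^ 2 / a_l ^ 3) * D := by field_simp
    _ ≤ (√2 * a_u / a_l ^ 2 + 8 * a_u ^ 2 / a_l ^ 3) * D := by
        gcongr
        norm_num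
end
end
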